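/- arXiv:cs/0602081 — 2 statements merged into one kernel-verified Lean document; each statement's English description precedes it below -/
import Mathlib

section
/- Let ξ ∈ (0,1), let k_v, k_c > 0 be constants, and let λ, ρ be degree distributions whose maximal degrees are at most k_v·a and k_c·a respectively, where a is defined by 1/a = ∫₀¹ ρ(x) dx. Then for every x ∈ (0, ξ]: | (d²/dx²)[ λ(1−ρ(1−x)) ] | ≤ k_v²·k_c²·ρ(1−x)²·a⁴/(1−ξ)² + k_v·k_c²·ρ(1−x)·a³/(1−ξ)². -/
open scoped BigOperators

/-- A degree distribution: a real polynomial `γ(x) = ∑_{i=2}^{D} γ_i x^(i-1)` whose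
coefficients are nonnegative and sum to `1`; `D` (the largest index with `γ_D ≠ 0`)
is called the maximal degree. -/
structure DegreeDist where
  c : ℕ → ℝ
  D : ℕ
  two_le_D : 2 ≤ D
  nonneg : ∀ i, 0 ≤ c i
  supp : ∀ i, c i ≠ 0 → 2 ≤ i ∧ i ≤ D
  cD_ne : c D ≠ 0
  sum_eq_one : ∑ i ∈ Finset.Icc 2 D, c i = 1

/-- Evaluation of a degree distribution at a real `x`. -/
noncomputable def DegreeDist.eval (γ : DegreeDist) (x : ℝ) : ℝ :=
  ∑ i ∈ Finset.Icc 2 γ.D, γ.c i * x ^ (i - 1)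

namespace DegreeDist

open Polynomial

/-- The polynomial underlying a degree distribution. -/
noncomputable def toPoly (γ : DegreeDist) : ℝ[X] :=
  ∑ i ∈ Finset.Icc 2 γ.D, C (γ.c i) * X ^ (i - 1)

theorem eval_toPoly (γ : DegreeDist) (x : ℝ) : γ.toPoly.eval x = γ.eval x := by
  simp [toPoly, DegreeDist.eval, eval_finsetSum]

theorem eval_derivative_toPoly (γ : DegreeDist) (x : ℝ) :
    (derivative γ.toPoly).eval x =
      ∑ i ∈ Finset.Icc 2 γ.D, γ.c i * (((i - 1 : ℕ) : ℝ) * x ^ (i - 1 - 1)) := by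
  simp [toPoly, eval_finsetSum, derivative_X_pow]

theorem eval_derivative_derivative_toPoly (γ : DegreeDist) (x : ℝ) :
    (derivative (derivative γ.toPoly)).eval x =
      ∑ i ∈ Finset.Icc 2 γ.D,
        γ.c i * (((i - 1 : ℕ) : ℝ) * (((i - 1 - 1 : ℕ) : ℝ) * x ^ (i - 1 - 1 - 1))) := by
  simp [toPoly, eval_finsetSum, derivative_X_pow]

theorem eval_nonneg (γ : DegreeDist) {x : ℝ} (hx : 0 ≤ x) : 0 ≤ γ.eval x :=
  Finset.sum_nonneg fun i _ => mul_nonneg (γ.nonneg i) (pow_nonneg hx _)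

theorem sum_mul_le (γ : DegreeDist) {f : ℕ → ℝ} {b : ℝ}
    (hf : ∀ i ∈ Finset.Icc 2 γ.D, f i ≤ b) : ∑ i ∈ Finset.Icc 2 γ.D, γ.c i * f i ≤ b := by
  calc ∑ i ∈ Finset.Icc 2 γ.D, γ.c i * f i ≤ ∑ i ∈ Finset.Icc 2 γ.D, γ.c i * b :=
        Finset.sum_le_sum fun i hi => mul_le_mul_of_nonneg_left (hf i hi) (γ.nonneg i)
    _ = b := by rw [← Finset.sum_mul, γ.sum_eq_one, one_mul]

theorem eval_le_one (γ : DegreeDist) {x : ℝ} (hx : 0 ≤ x) (hx1 : x ≤ 1) : γ.eval x ≤ 1 :=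
  γ.sum_mul_le fun _ _ => pow_le_one₀ hx hx1

theorem cast_sub_one_le (γ : DegreeDist) {i : ℕ} (hi : i ∈ Finset.Icc 2 γ.D) :
    ((i - 1 : ℕ) : ℝ) ≤ γ.D := by
  have := (Finset.mem_Icc.1 hi).2
  exact_mod_cast (by omega : i - 1 ≤ γ.D)

theorem cast_sub_one_sub_one_le (γ : DegreeDist) {i : ℕ} (hi : i ∈ Finset.Icc 2 γ.D) :
    ((i - 1 - 1 : ℕ) : ℝ) ≤ γ.D := by
  have := (Finset.mem_Icc.1 hi).2
  exact_mod_cast (by omega : i - 1 - 1 ≤ γ.D)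

theorem eval_derivative_nonneg (γ : DegreeDist) {x : ℝ} (hx : 0 ≤ x) :
    0 ≤ (derivative γ.toPoly).eval x := by
  rw [eval_derivative_toPoly]
  exact Finset.sum_nonneg fun i _ => mul_nonneg (γ.nonneg i) (by positivity)

theorem eval_derivative_derivative_nonneg (γ : DegreeDist) {x : ℝ} (hx : 0 ≤ x) :
    0 ≤ (derivative (derivative γ.toPoly)).eval x := by
  rw [eval_derivative_derivative_toPoly]
  exact Finset.sum_nonneg fun i _ => mul_nonneg (γ.nonneg i) (by positivity)

theorem eval_derivative_le (γ : DegreeDist) {x : ℝ} (hx : 0 ≤ x) (hx1 : x ≤ 1) :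
    (derivative γ.toPoly).eval x ≤ γ.D := by
  rw [eval_derivative_toPoly]
  refine γ.sum_mul_le fun i hi => ?_
  exact (mul_le_of_le_one_right (by positivity) (pow_le_one₀ hx hx1)).trans (γ.cast_sub_one_le hi)

theorem eval_derivative_derivative_le (γ : DegreeDist) {x : ℝ} (hx : 0 ≤ x) (hx1 : x ≤ 1) :
    (derivative (derivative γ.toPoly)).eval x ≤ (γ.D : ℝ) ^ 2 := by
  rw [eval_derivative_derivative_toPoly, sq]
  refine γ.sum_mul_le fun i hi => ?_
  refine mul_le_mul (γ.cast_sub_one_le hi) ?_ (by positivity) (by positivity)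
  exact (mul_le_of_le_one_right (by positivity) (pow_le_one₀ hx hx1)).trans
    (γ.cast_sub_one_sub_one_le hi)

theorem mul_eval_derivative_le (γ : DegreeDist) {x : ℝ} (hx : 0 ≤ x) :
    x * (derivative γ.toPoly).eval x ≤ γ.D * γ.eval x := by
  rw [eval_derivative_toPoly, DegreeDist.eval, Finset.mul_sum, Finset.mul_sum]
  refine Finset.sum_le_sum fun i hi => ?_
  have h := γ.cast_sub_one_le hi
  obtain ⟨j, rfl⟩ := Nat.exists_eq_add_of_le' (Finset.mem_Icc.1 hi).1
  have hc := mul_nonneg (γ.nonneg (j + 2)) (pow_nonneg hx (j + 1))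
  calc _ = ((j + 2 - 1 : ℕ) : ℝ) * (γ.c (j + 2) * x ^ (j + 1)) := by
        simp only [show j + 2 - 1 - 1 = j by omega]; ring
    _ ≤ _ := mul_le_mul_of_nonneg_right h hc

theorem sq_mul_eval_derivative_derivative_le (γ : DegreeDist) {x : ℝ} (hx : 0 ≤ x) :
    x ^ 2 * (derivative (derivative γ.toPoly)).eval x ≤ (γ.D : ℝ) ^ 2 * γ.eval x := by
  rw [eval_derivative_derivative_toPoly, DegreeDist.eval, Finset.mul_sum, Finset.mul_sum]
  refine Finset.sum_le_sum fun i hi => ?_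
  have h := mul_le_mul (γ.cast_sub_one_le hi) (γ.cast_sub_one_sub_one_le hi)
    (by positivity) (by positivity)
  have hc := mul_nonneg (γ.nonneg i) (pow_nonneg hx (i - 1))
  rw [sq (γ.D : ℝ)]
  refine le_trans (le_of_eq ?_) (mul_le_mul_of_nonneg_right h hc)
  obtain ⟨j, rfl⟩ := Nat.exists_eq_add_of_le' (Finset.mem_Icc.1 hi).1
  rcases j with _ | j
  · simp
  · simp only [show j + 1 + 2 - 1 = j + 2 by omega, show j + 2 - 1 - 1 = j by omega]
    ring

theorem deriv_deriv_eval_comp (γ δ : DegreeDist) (x : ℝ) :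
    deriv (deriv (fun t => γ.eval (1 - δ.eval (1 - t)))) x =
      (derivative (derivative γ.toPoly)).eval (1 - δ.eval (1 - x)) *
          (derivative δ.toPoly).eval (1 - x) ^ 2 -
        (derivative γ.toPoly).eval (1 - δ.eval (1 - x)) *
          (derivative (derivative δ.toPoly)).eval (1 - x) := by
  have h : (fun t => γ.eval (1 - δ.eval (1 - t))) =
      fun t => (γ.toPoly.comp (1 - δ.toPoly.comp (1 - X))).eval t := by
    ext t
    simp [eval_comp, eval_toPoly]
  have hd (p : ℝ[X]) : deriv (fun t => p.eval t) = fun t => (derivative p).eval t := by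
    ext t
    exact p.deriv
  rw [h, hd, hd]
  simp [derivative_comp, eval_comp, eval_toPoly]
  ring

end DegreeDist

/-- bound on `|(d²/dx²)[λ(1−ρ(1−x))]|` on `(0, ξ]`. -/
theorem stmt5 (ξ a kv kc : ℝ) (hξ : ξ ∈ Set.Ioo (0:ℝ) 1) (hkv : 0 < kv) (hkc : 0 < kc)
    (lam ρ : DegreeDist)
    (ha : 1 / a = ∫ x in (0:ℝ)..1, ρ.eval x)
    (hdegv : (lam.D : ℝ) ≤ kv * a) (hdegc : (ρ.D : ℝ) ≤ kc * a) :
    ∀ x ∈ Set.Ioc (0:ℝ) ξ,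
      |deriv (deriv (fun t => lam.eval (1 - ρ.eval (1 - t)))) x| ≤
        kv ^ 2 * kc ^ 2 * ρ.eval (1 - x) ^ 2 * a ^ 4 / (1 - ξ) ^ 2 +
          kv * kc ^ 2 * ρ.eval (1 - x) * a ^ 3 / (1 - ξ) ^ 2 := by
  intro x hx
  rw [DegreeDist.deriv_deriv_eval_comp]
  have hξ0 : 0 < 1 - ξ := sub_pos.2 hξ.2
  have hξy : 1 - ξ ≤ 1 - x := by linarith [hx.2]
  have hy0 : 0 < 1 - x := hξ0.trans_le hξy
  have hy1 : 1 - x ≤ 1 := by linarith [hx.1]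
  set y := 1 - x
  have hr0 := ρ.eval_nonneg hy0.le
  have hr1 := ρ.eval_le_one hy0.le hy1
  have hu0 : 0 ≤ 1 - ρ.eval y := by linarith
  have hu1 : 1 - ρ.eval y ≤ 1 := by linarith
  have hkva : 0 ≤ kv * a := (Nat.cast_nonneg _).trans hdegv
  have hL1 := (lam.eval_derivative_le hu0 hu1).trans hdegv
  have hL2 := (lam.eval_derivative_derivative_le hu0 hu1).trans
    (pow_le_pow_left₀ (by positivity) hdegv 2)
  have hL1n := lam.eval_derivative_nonneg hu0
  have hL2n := lam.eval_derivative_derivative_nonneg hu0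
  have hR1n := ρ.eval_derivative_nonneg hy0.le
  have hR2n := ρ.eval_derivative_derivative_nonneg hy0.le
  have hR1 := ((mul_le_mul_of_nonneg_right hξy hR1n).trans
    (ρ.mul_eval_derivative_le hy0.le)).trans (mul_le_mul_of_nonneg_right hdegc hr0)
  have hR2 := ((mul_le_mul_of_nonneg_right (pow_le_pow_left₀ hξ0.le hξy 2) hR2n).trans
    (ρ.sq_mul_eval_derivative_derivative_le hy0.le)).trans
    (mul_le_mul_of_nonneg_right (pow_le_pow_left₀ (by positivity) hdegc 2) hr0)
  rw [mul_comm, ← le_div_iff₀ hξ0] at hR1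
  rw [mul_comm, ← le_div_iff₀ (by positivity)] at hR2
  have hA := mul_le_mul hL2 (pow_le_pow_left₀ hR1n hR1 2) (by positivity) (by positivity)
  have hB := mul_le_mul hL1 hR2 hR2n hkva
  refine (abs_sub _ _).trans ?_
  rw [abs_of_nonneg (mul_nonneg hL2n (sq_nonneg _)), abs_of_nonneg (mul_nonneg hL1n hR2n)]
  refine (add_le_add hA hB).trans (le_of_eq ?_)
  field_simp
end

section
/- Let ξ ∈ (0,1), let k_v, k_c > 0 be constants, and let λ, ρ be degree distributions whose maximal degrees are at most k_v·a and k_c·a respectively, where a is defined by 1/a = ∫₀¹ ρ(x) dx; set b = 1/a, R = 1 − (∫₀¹ρ)/(∫₀¹λ), ΔR = (1−ξ) − R. Assume the successful decoding condition ξ·λ(1−ρ(1−x)) < x for all x ∈ (0, ξ], that b⁵ + b² < ξ, and let x satisfy b⁵ < x < ξ − b². Then (d/dx)[1 − λ^{-1}(x/ξ)] / (d/dx)[ρ(1−x)] ≤ 1 + √(k_c)·B(ΔR, b, x)·a⁵ + (k_c·b⁴/(2(1−ξ)))·(1 + b⁵/(1−ξ))^{k_c·a}, where B(ΔR, b, x)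 = √( 2ΔR / ((ξ+ΔR)(1−ξ)·ρ(1−x)) ) and λ^{-1} is the inverse of λ on [0,1]. -/
open scoped BigOperators

namespace DegreeDist

variable (γ : DegreeDist)

/-- The derivative of a degree distribution. -/
noncomputable def derivEval (x : ℝ) : ℝ :=
  ∑ i ∈ Finset.Icc 2 γ.D, γ.c i * (((i - 1 : ℕ) : ℝ) * x ^ (i - 1 - 1))

theorem hasDerivAt_eval (x : ℝ) : HasDerivAt γ.eval (γ.derivEval x) x := by
  unfold derivEval
  exact HasDerivAt.fun_sum fun i _ => (hasDerivAt_pow (i - 1) x).const_mul (γ.c i)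

theorem continuous_eval : Continuous γ.eval := by
  unfold eval
  fun_prop

theorem continuous_derivEval : Continuous γ.derivEval := by
  unfold derivEval
  fun_prop

theorem eval_zero : γ.eval 0 = 0 := by
  refine Finset.sum_eq_zero fun i hi => ?_
  rw [Finset.mem_Icc] at hi
  rw [zero_pow (by omega), mul_zero]

theorem eval_one : γ.eval 1 = 1 := by
  simp [eval, γ.sum_eq_one]

theorem c_D_pos : 0 < γ.c γ.D :=
  lt_of_le_of_ne (γ.nonneg _) γ.cD_ne.symm

theorem monotoneOn_eval : MonotoneOn γ.eval (Set.Ici 0) := by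
  intro u hu v _ huv
  exact Finset.sum_le_sum fun i _ =>
    mul_le_mul_of_nonneg_left (pow_le_pow_left₀ hu huv _) (γ.nonneg i)

theorem eval_pos {x : ℝ} (hx : 0 < x) : 0 < γ.eval x :=
  Finset.sum_pos' (fun i _ => mul_nonneg (γ.nonneg i) (by positivity))
    ⟨γ.D, Finset.mem_Icc.2 ⟨γ.two_le_D, le_rfl⟩, mul_pos γ.c_D_pos (by positivity)⟩

theorem eval_mem_Icc {x : ℝ} (hx : x ∈ Set.Icc (0 : ℝ) 1) : γ.eval x ∈ Set.Icc (0 : ℝ) 1 := by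
  constructor
  · rw [← γ.eval_zero]
    exact γ.monotoneOn_eval (Set.mem_Ici.2 le_rfl) hx.1 hx.1
  · rw [← γ.eval_one]
    exact γ.monotoneOn_eval hx.1 (Set.mem_Ici.2 zero_le_one) hx.2

theorem derivEval_nonneg {x : ℝ} (hx : 0 ≤ x) : 0 ≤ γ.derivEval x :=
  Finset.sum_nonneg fun i _ => mul_nonneg (γ.nonneg i) (by positivity)

theorem eval_le_mul_derivEval {x : ℝ} (hx : 0 ≤ x) : γ.eval x ≤ x * γ.derivEval x := by
  rw [eval, derivEval, Finset.mul_sum]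
  refine Finset.sum_le_sum fun i hi => ?_
  rw [Finset.mem_Icc] at hi
  obtain ⟨m, rfl⟩ := Nat.exists_eq_add_of_le' hi.1
  have e1 : m + 2 - 1 = m + 1 := rfl
  have e2 : m + 1 - 1 = m := rfl
  rw [e1, e2]
  have := mul_nonneg (mul_nonneg (γ.nonneg (m + 2)) (pow_nonneg hx (m + 1))) m.cast_nonneg
  push_cast
  rw [pow_succ] at this ⊢
  linarith

theorem convexOn_eval : ConvexOn ℝ (Set.Ici 0) γ.eval := by
  refine ⟨convex_Ici 0, fun u hu v hv p q hp hq hpq => ?_⟩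
  simp only [eval, smul_eq_mul, Finset.mul_sum]
  rw [← Finset.sum_add_distrib]
  refine Finset.sum_le_sum fun i _ => ?_
  have := (convexOn_pow (𝕜 := ℝ) (i - 1)).2 hu hv hp hq hpq
  simp only [smul_eq_mul] at this
  have := mul_le_mul_of_nonneg_left this (γ.nonneg i)
  linarith

theorem eval_sub_le {s t : ℝ} (hs : 0 ≤ s) (hst : s ≤ t) :
    γ.eval t - γ.eval s ≤ γ.derivEval t * (t - s) := by
  rcases hst.eq_or_lt with rfl | hlt
  · simp
  have := γ.convexOn_eval.slope_le_of_hasDerivAt (Set.mem_Ici.2 hs)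
    (Set.mem_Ici.2 (hs.trans hst)) hlt (γ.hasDerivAt_eval t)
  rwa [slope_def_field, div_le_iff₀ (sub_pos.2 hlt)] at this

end DegreeDist

theorem add_pow_succ_le_of_le {e y h : ℝ} (he : 0 < e) (hy : e ≤ y) (hh : 0 ≤ h) (m : ℕ) :
    (y + h) ^ (m + 1) ≤
      y ^ m * (y + (m + 1) * h + (m + 1) * m / (2 * e) * h ^ 2 * (1 + h / e) ^ m) := by
  have hy0 : 0 < y := he.trans_le hy
  induction m with
  | zero => simp
  | succ m ih =>
    set q := 1 + h / e with hq
    have hq1 : 1 ≤ q := by rw [hq]; linarith [div_nonneg hh he.le]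
    have hqp : 1 ≤ q ^ (m + 1) := one_le_pow₀ hq1
    have hyq : y + h ≤ y * q := by
      have : 1 * h ≤ y / e * h := mul_le_mul_of_nonneg_right ((one_le_div he).2 hy) hh
      have e1 : y * q = y + y / e * h := by rw [hq]; ring
      linarith
    set C : ℝ := (m + 1) * m / (2 * e) * h ^ 2 * q ^ m with hC
    have hC0 : 0 ≤ C := by positivity
    have h1 : (y + h) * C ≤ y * q * C := mul_le_mul_of_nonneg_right hyq hC0
    have h2 : (m + 1 : ℝ) * h ^ 2 ≤ y * ((m + 1) / e * h ^ 2 * q ^ (m + 1)) := by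
      have h3 : 1 * 1 ≤ y / e * q ^ (m + 1) :=
        mul_le_mul ((one_le_div he).2 hy) hqp zero_le_one (by positivity)
      have h4 : (0 : ℝ) ≤ (m + 1) * h ^ 2 := by positivity
      have h5 := mul_le_mul_of_nonneg_left h3 h4
      calc (m + 1 : ℝ) * h ^ 2 = (m + 1) * h ^ 2 * (1 * 1) := by ring
        _ ≤ _ := h5
        _ = _ := by ring
    have h6 : y * q * C + y * ((m + 1) / e * h ^ 2 * q ^ (m + 1)) =
        y * ((m + 1 + 1) * (m + 1) / (2 * e) * h ^ 2 * q ^ (m + 1)) := by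
      rw [hC]; field_simp; ring
    calc (y + h) ^ (m + 1 + 1) = (y + h) ^ (m + 1) * (y + h) := pow_succ _ _
      _ ≤ y ^ m * (y + (m + 1) * h + C) * (y + h) :=
        mul_le_mul_of_nonneg_right ih (by positivity)
      _ = y ^ m * (y ^ 2 + (m + 2) * h * y + ((m + 1) * h ^ 2 + (y + h) * C)) := by ring
      _ ≤ y ^ m * (y ^ 2 + (m + 2) * h * y +
            y * ((m + 1 + 1) * (m + 1) / (2 * e) * h ^ 2 * q ^ (m + 1))) := by
        refine mul_le_mul_of_nonneg_left ?_ (by positivity)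
        linarith
      _ = _ := by push_cast; ring

namespace DegreeDist

variable (γ : DegreeDist)

theorem eval_add_le {e y h M : ℝ} (he : 0 < e) (hy : e ≤ y) (hh : 0 ≤ h) (hM : (γ.D : ℝ) ≤ M) :
    γ.eval (y + h) ≤ γ.eval y + h * γ.derivEval y +
      M / (2 * e) * h ^ 2 * (1 + h / e) ^ M * γ.derivEval y := by
  have hy0 : 0 < y := he.trans_le hy
  have hM0 : 0 ≤ M := (Nat.cast_nonneg _).trans hM
  have hq1 : 1 ≤ 1 + h / e := by linarith [div_nonneg hh he.le]
  rw [eval, eval, derivEval, Finset.mul_sum, Finset.mul_sum, ← Finset.sum_add_distrib,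
    ← Finset.sum_add_distrib]
  refine Finset.sum_le_sum fun i hi => ?_
  rw [Finset.mem_Icc] at hi
  obtain ⟨m, rfl⟩ := Nat.exists_eq_add_of_le' hi.1
  have e1 : m + 2 - 1 = m + 1 := rfl
  have e2 : m + 1 - 1 = m := rfl
  rw [e1, e2]
  have hmM : (m : ℝ) ≤ M := by
    have : ((m + 2 : ℕ) : ℝ) ≤ γ.D := Nat.cast_le.2 hi.2
    push_cast at this
    linarith
  have hpow : (1 + h / e) ^ m ≤ (1 + h / e) ^ M := by
    rw [← Real.rpow_natCast]
    exact Real.rpow_le_rpow_of_exponent_le hq1 hmM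
  have h1 : (m : ℝ) * (1 + h / e) ^ m ≤ M * (1 + h / e) ^ M :=
    mul_le_mul hmM hpow (by positivity) hM0
  have h2 := mul_le_mul_of_nonneg_left h1
    (show (0 : ℝ) ≤ y ^ m * ((m + 1) / (2 * e) * h ^ 2) by positivity)
  have h3 : (y + h) ^ (m + 1) ≤ y ^ (m + 1) + h * ((m + 1) * y ^ m) +
      M / (2 * e) * h ^ 2 * (1 + h / e) ^ M * ((m + 1) * y ^ m) := by
    refine (add_pow_succ_le_of_le he hy hh m).trans ?_
    calc _ = y ^ (m + 1) + h * ((m + 1) * y ^ m) +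
          y ^ m * ((m + 1) / (2 * e) * h ^ 2) * (m * (1 + h / e) ^ m) := by ring
      _ ≤ y ^ (m + 1) + h * ((m + 1) * y ^ m) +
          y ^ m * ((m + 1) / (2 * e) * h ^ 2) * (M * (1 + h / e) ^ M) := by linarith
      _ = _ := by ring
  have h4 := mul_le_mul_of_nonneg_left h3 (γ.nonneg (m + 2))
  push_cast
  linarith

theorem integral_eval_pos : 0 < ∫ x in (0 : ℝ)..1, γ.eval x :=
  intervalIntegral.intervalIntegral_pos_of_pos_on (γ.continuous_eval.intervalIntegrable _ _)
    (fun _ hx => γ.eval_pos hx.1) zero_lt_one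

/-- The area between two decoding curves, in the coordinate of the right distribution. -/
theorem integral_sub_mul_integral_eq (lam ρ : DegreeDist) (ξ : ℝ) :
    (∫ s in (0 : ℝ)..1, ρ.eval s) - ξ * ∫ u in (0 : ℝ)..1, lam.eval u =
      ∫ s in (0 : ℝ)..1, (1 - s - ξ * lam.eval (1 - ρ.eval s)) * ρ.derivEval s := by
  have c1 := ρ.continuous_eval
  have c2 := ρ.continuous_derivEval
  have c3 := lam.continuous_eval
  have h1 : ∫ s in (0 : ℝ)..1, (1 - s) * ρ.derivEval s = ∫ s in (0 : ℝ)..1, ρ.eval s := by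
    rw [intervalIntegral.integral_mul_deriv_eq_deriv_mul (u := fun s => 1 - s)
      (u' := fun _ => -1) (v := ρ.eval)
      (fun s _ => by simpa using (hasDerivAt_id s).const_sub 1)
      (fun s _ => ρ.hasDerivAt_eval s) (by simp) (c2.intervalIntegrable _ _)]
    simp [ρ.eval_zero]
  have h2 : ∫ s in (0 : ℝ)..1, lam.eval (1 - ρ.eval s) * ρ.derivEval s =
      ∫ u in (0 : ℝ)..1, lam.eval u := by
    have := intervalIntegral.integral_comp_mul_deriv (a := 0) (b := 1)
      (f := fun s => 1 - ρ.eval s) (f' := fun s => -ρ.derivEval s) (g := lam.eval)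
      (fun s _ => (ρ.hasDerivAt_eval s).const_sub 1) (by fun_prop) c3
    simp only [Function.comp, mul_neg, intervalIntegral.integral_neg, ρ.eval_zero, ρ.eval_one,
      sub_zero, sub_self] at this
    rw [intervalIntegral.integral_symm 0 1] at this
    linarith
  rw [← h1, ← h2, ← intervalIntegral.integral_const_mul, ← intervalIntegral.integral_sub]
  · exact intervalIntegral.integral_congr fun s _ => by ring
  · exact Continuous.intervalIntegrable (by fun_prop) _ _
  · exact Continuous.intervalIntegrable (by fun_prop) _ _

/-- The squared vertical gap between the decoding curves at `1 - s₀` is controlled by the area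
between them. -/
theorem sq_gap_le {lam ρ : DegreeDist} {ξ s₀ v : ℝ}
    (hdec : ∀ x ∈ Set.Ioc (0 : ℝ) ξ, ξ * lam.eval (1 - ρ.eval (1 - x)) < x)
    (hξ : 0 ≤ ξ) (hs₀ : 0 < s₀) (hs₁ : s₀ ≤ 1) (hv : v ≤ 1)
    (hlam : ξ * lam.eval v = 1 - s₀) (hgap : 1 - v ≤ ρ.eval s₀) :
    (ρ.eval s₀ - (1 - v)) ^ 2 ≤ 2 * ρ.derivEval s₀ *
      ((∫ s in (0 : ℝ)..1, ρ.eval s) - ξ * ∫ u in (0 : ℝ)..1, lam.eval u) := by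
  have c1 := ρ.continuous_eval
  have c2 := ρ.continuous_derivEval
  have c3 := lam.continuous_eval
  have hP := ρ.derivEval_nonneg hs₀.le
  obtain ⟨s₁, hs, hr⟩ : 1 - v ∈ ρ.eval '' Set.Icc 0 s₀ :=
    intermediate_value_Icc hs₀.le c1.continuousOn
      ⟨by rw [ρ.eval_zero]; linarith, hgap⟩
  have hnonneg : ∀ s ∈ Set.Icc (0 : ℝ) 1,
      0 ≤ (1 - s - ξ * lam.eval (1 - ρ.eval s)) * ρ.derivEval s := by
    intro s hs
    refine mul_nonneg ?_ (ρ.derivEval_nonneg hs.1)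
    rcases hs.2.eq_or_lt with rfl | h1
    · simp [ρ.eval_one, lam.eval_zero]
    by_cases h2 : 1 - s ≤ ξ
    · have := hdec (1 - s) ⟨by linarith, h2⟩
      rw [sub_sub_cancel] at this
      linarith
    · have h3 := ρ.eval_mem_Icc hs
      have h4 := (lam.eval_mem_Icc (x := 1 - ρ.eval s) ⟨by linarith [h3.2], by linarith [h3.1]⟩).2
      nlinarith
  have hmono : ∫ s in s₁..s₀, (1 - s - ξ * lam.eval (1 - ρ.eval s)) * ρ.derivEval s ≤
      ∫ s in (0 : ℝ)..1, (1 - s - ξ * lam.eval (1 - ρ.eval s)) * ρ.derivEval s := by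
    refine intervalIntegral.integral_mono_interval hs.1 hs.2 hs₁ ?_
      (Continuous.intervalIntegrable (by fun_prop) _ _)
    refine (MeasureTheory.ae_restrict_iff' measurableSet_Ioc).2 (.of_forall fun s h => ?_)
    exact hnonneg s ⟨h.1.le, h.2⟩
  have hsq : ∫ s in s₁..s₀, (ρ.eval s₀ - ρ.eval s) * ρ.derivEval s =
      (ρ.eval s₀ - (1 - v)) ^ 2 / 2 := by
    rw [intervalIntegral.integral_eq_sub_of_hasDerivAt
      (f := fun s => -((ρ.eval s₀ - ρ.eval s) ^ 2 / 2))
      (fun s _ => ?_) (Continuous.intervalIntegrable (by fun_prop) _ _), hr]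
    · ring
    · have hder := (ρ.hasDerivAt_eval s).const_sub (ρ.eval s₀)
      refine ((hder.fun_pow 2).div_const 2).fun_neg.congr_deriv ?_
      norm_num
      ring
  have hlow : ∫ s in s₁..s₀, (ρ.eval s₀ - ρ.eval s) * ρ.derivEval s ≤ ρ.derivEval s₀ *
      ∫ s in s₁..s₀, (1 - s - ξ * lam.eval (1 - ρ.eval s)) * ρ.derivEval s := by
    rw [← intervalIntegral.integral_const_mul]
    refine intervalIntegral.integral_mono_on hs.2
      (Continuous.intervalIntegrable (by fun_prop) _ _)
      (Continuous.intervalIntegrable (by fun_prop) _ _) fun s h => ?_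
    have hs0 : 0 ≤ s := hs.1.trans h.1
    rw [← mul_assoc]
    refine mul_le_mul_of_nonneg_right ((ρ.eval_sub_le hs0 h.2).trans ?_) (ρ.derivEval_nonneg hs0)
    refine mul_le_mul_of_nonneg_left ?_ hP
    have h1 : 1 - ρ.eval s ≤ v := by
      have := ρ.monotoneOn_eval hs.1 hs0 h.1
      linarith
    have h0 := (ρ.eval_mem_Icc ⟨hs0, h.2.trans hs₁⟩).2
    have h2 := lam.monotoneOn_eval (Set.mem_Ici.2 (sub_nonneg.2 h0))
      (Set.mem_Ici.2 ((sub_nonneg.2 h0).trans h1)) h1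
    have := mul_le_mul_of_nonneg_left h2 hξ
    linarith
  rw [integral_sub_mul_integral_eq]
  have := mul_le_mul_of_nonneg_left hmono hP
  linarith

/-- A right inverse of a degree distribution is concave. -/
theorem concaveOn_of_rightInverse {lam : DegreeDist} {linv : ℝ → ℝ}
    (hmaps : ∀ y ∈ Set.Icc (0 : ℝ) 1, linv y ∈ Set.Icc (0 : ℝ) 1)
    (hleft : ∀ x ∈ Set.Icc (0 : ℝ) 1, linv (lam.eval x) = x)
    (hright : ∀ y ∈ Set.Icc (0 : ℝ) 1, lam.eval (linv y) = y) :
    ConcaveOn ℝ (Set.Icc 0 1) linv := by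
  refine ⟨convex_Icc 0 1, fun y hy z hz p q hp hq hpq => ?_⟩
  have hm := convex_Icc (0 : ℝ) 1 hy hz hp hq hpq
  have hm' := convex_Icc (0 : ℝ) 1 (hmaps y hy) (hmaps z hz) hp hq hpq
  have hconv := lam.convexOn_eval.2 (hmaps y hy).1 (hmaps z hz).1 hp hq hpq
  rw [hright y hy, hright z hz] at hconv
  by_contra! hlt
  have h1 := lam.monotoneOn_eval (hmaps _ hm).1 hm'.1 hlt.le
  rw [hright _ hm] at h1
  have h2 := hleft _ hm'
  rw [le_antisymm hconv h1] at h2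
  exact hlt.ne h2

end DegreeDist

/-- upper bound on `(d/dx)[1−λ⁻¹(x/ξ)] / (d/dx)[ρ(1−x)]` for
`b⁵ < x < ξ − b²`; the exponent `k_c·a` is a real power. -/
theorem stmt7 (ξ a b R dR kv kc : ℝ) (hξ : ξ ∈ Set.Ioo (0:ℝ) 1)
    (hkv : 0 < kv) (hkc : 0 < kc)
    (lam ρ : DegreeDist)
    (linv : ℝ → ℝ)
    (hmaps : ∀ y ∈ Set.Icc (0:ℝ) 1, linv y ∈ Set.Icc (0:ℝ) 1)
    (hleft : ∀ x ∈ Set.Icc (0:ℝ) 1, linv (lam.eval x) = x)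
    (hright : ∀ y ∈ Set.Icc (0:ℝ) 1, lam.eval (linv y) = y)
    (ha : 1 / a = ∫ x in (0:ℝ)..1, ρ.eval x)
    (hb : b = 1 / a)
    (hR : R = 1 - (∫ x in (0:ℝ)..1, ρ.eval x) / (∫ x in (0:ℝ)..1, lam.eval x))
    (hdR : dR = (1 - ξ) - R)
    (hdegv : (lam.D : ℝ) ≤ kv * a) (hdegc : (ρ.D : ℝ) ≤ kc * a)
    (hdec : ∀ x ∈ Set.Ioc (0:ℝ) ξ, ξ * lam.eval (1 - ρ.eval (1 - x)) < x)
    (hbs : b ^ 5 + b ^ 2 < ξ)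
    (x : ℝ) (hx1 : b ^ 5 < x) (hx2 : x < ξ - b ^ 2) :
    deriv (fun t => 1 - linv (t / ξ)) x / deriv (fun t => ρ.eval (1 - t)) x ≤
      1 + Real.sqrt kc * Real.sqrt (2 * dR / ((ξ + dR) * (1 - ξ) * ρ.eval (1 - x))) * a ^ 5 +
        kc * b ^ 4 / (2 * (1 - ξ)) * (1 + b ^ 5 / (1 - ξ)) ^ (kc * a) := by
  obtain ⟨hξ0, hξ1⟩ := hξ
  have hb' : b = ∫ x in (0 : ℝ)..1, ρ.eval x := hb.trans ha
  have hb0 : 0 < b := hb' ▸ ρ.integral_eval_pos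
  have ha0 : 0 < a := by
    rw [hb] at hb0
    exact one_div_pos.1 hb0
  have hba : a * b = 1 := by rw [hb]; field_simp
  have hx0 : 0 < x := (pow_pos hb0 5).trans hx1
  have hxξ : x < ξ := by linarith [pow_pos hb0 2]
  have hgap : ∀ t ∈ Set.Ioc (0 : ℝ) ξ, 1 - linv (t / ξ) ≤ ρ.eval (1 - t) := by
    intro t ht
    have hy : t / ξ ∈ Set.Icc (0 : ℝ) 1 := ⟨div_nonneg ht.1.le hξ0.le, (div_le_one hξ0).2 ht.2⟩
    have hg := (ρ.eval_mem_Icc (x := 1 - t) ⟨by linarith [ht.2], by linarith [ht.1]⟩)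
    by_contra! hlt
    have h1 := lam.monotoneOn_eval (hmaps _ hy).1 (Set.mem_Ici.2 (sub_nonneg.2 hg.2))
      (show linv (t / ξ) ≤ 1 - ρ.eval (1 - t) by linarith)
    rw [hright _ hy, div_le_iff₀ hξ0] at h1
    have := hdec t ht
    linarith
  have hy : x / ξ ∈ Set.Icc (0 : ℝ) 1 := ⟨div_nonneg hx0.le hξ0.le, (div_le_one hξ0).2 hxξ.le⟩
  have hs₀ : 0 < 1 - x := by linarith
  have hG := ρ.eval_pos hs₀
  have hGP : ρ.eval (1 - x) ≤ ρ.derivEval (1 - x) :=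
    (ρ.eval_le_mul_derivEval hs₀.le).trans
      (mul_le_of_le_one_left (ρ.derivEval_nonneg hs₀.le) (by linarith))
  have hP : 0 < ρ.derivEval (1 - x) := hG.trans_le hGP
  have hsq := DegreeDist.sq_gap_le hdec hξ0.le hs₀ (by linarith) (hmaps _ hy).2
    (by rw [hright _ hy]; field_simp; ring) (hgap x ⟨hx0, hxξ.le⟩)
  have hd0 := hgap x ⟨hx0, hxξ.le⟩
  have hL := lam.integral_eval_pos
  rw [← hb'] at hsq hR
  set L := ∫ x in (0 : ℝ)..1, lam.eval x
  set G := ρ.eval (1 - x) with hGdef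
  set P := ρ.derivEval (1 - x) with hPdef
  set d := G - (1 - linv (x / ξ)) with hd
  have hA : ξ + dR = b / L := by rw [hdR, hR]; ring
  have hdR' : dR = b / L - ξ := by linarith
  have hE : b - ξ * L = b * (dR / (ξ + dR)) := by
    rw [hA, hdR']; field_simp
  set E := dR / (ξ + dR) with hEdef
  rw [hE] at hsq
  have hE0 : 0 ≤ E := by
    have h1 : 0 ≤ 2 * P * b * E := by linarith [sq_nonneg d]
    exact nonneg_of_mul_nonneg_right h1 (by positivity)
  have hkcb : b ≤ kc := by
    have h2 : (2 : ℝ) ≤ ρ.D := by exact_mod_cast ρ.two_le_D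
    have h3 := mul_le_mul_of_nonneg_right (h2.trans hdegc) hb0.le
    rw [mul_assoc, hba] at h3
    linarith
  have he : 0 < 1 - ξ := by linarith
  have hsqrt : d / P ≤
      Real.sqrt kc * Real.sqrt (2 * dR / ((ξ + dR) * (1 - ξ) * G)) := by
    rw [← Real.sqrt_mul hkc.le]
    apply Real.le_sqrt_of_sq_le
    have h1 : kc * (2 * dR / ((ξ + dR) * (1 - ξ) * G)) = 2 * E * kc / ((1 - ξ) * G) := by
      rw [hEdef]; simp only [div_eq_mul_inv, mul_inv]; ring
    have h3 : b * ((1 - ξ) * G) ≤ kc * P := by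
      refine mul_le_mul hkcb ?_ (by positivity) hkc.le
      exact (mul_le_of_le_one_left hG.le (by linarith)).trans hGP
    rw [h1, div_pow, div_le_div_iff₀ (by positivity) (by positivity)]
    calc d ^ 2 * ((1 - ξ) * G) ≤ 2 * P * (b * E) * ((1 - ξ) * G) :=
          mul_le_mul_of_nonneg_right hsq (by positivity)
      _ = 2 * P * E * (b * ((1 - ξ) * G)) := by ring
      _ ≤ 2 * P * E * (kc * P) := mul_le_mul_of_nonneg_left h3 (by positivity)
      _ = 2 * E * kc * P ^ 2 := by ring
  have hderiv : deriv (fun t => ρ.eval (1 - t)) x = -P := by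
    rw [deriv_comp_const_sub, (ρ.hasDerivAt_eval (1 - x)).deriv]
  have hconv : ConvexOn ℝ (Set.Icc 0 ξ) (fun t => 1 - linv (t / ξ)) := by
    have hc := DegreeDist.concaveOn_of_rightInverse hmaps hleft hright
    refine ⟨convex_Icc 0 ξ, fun s hs t ht p q hp hq hpq => ?_⟩
    have hm : ∀ t ∈ Set.Icc 0 ξ, t / ξ ∈ Set.Icc (0 : ℝ) 1 := fun t ht =>
      ⟨div_nonneg ht.1 hξ0.le, (div_le_one hξ0).2 ht.2⟩
    have := hc.2 (hm s hs) (hm t ht) hp hq hpq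
    simp only [smul_eq_mul] at this ⊢
    rw [show (p * s + q * t) / ξ = p * (s / ξ) + q * (t / ξ) by ring]
    linarith
  have hh : 0 < b ^ 5 := pow_pos hb0 5
  have hT : 0 ≤ kc * b ^ 4 / (2 * (1 - ξ)) * (1 + b ^ 5 / (1 - ξ)) ^ (kc * a) := by positivity
  rw [hderiv]
  by_cases hdiff : DifferentiableAt ℝ (fun t => 1 - linv (t / ξ)) x
  swap
  · rw [deriv_zero_of_not_differentiableAt hdiff, zero_div]
    positivity
  have hslope := hconv.slope_le_of_hasDerivAt (x := x - b ^ 5) (y := x)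
    ⟨by linarith, by linarith⟩ ⟨hx0.le, hxξ.le⟩ (by linarith) hdiff.hasDerivAt
  set N := deriv (fun t => 1 - linv (t / ξ)) x
  rw [slope_def_field, sub_sub_cancel, div_le_iff₀ hh] at hslope
  have hleftgap := hgap (x - b ^ 5) ⟨by linarith, by linarith⟩
  have htaylor := ρ.eval_add_le (y := 1 - x) he (by linarith) hh.le hdegc
  rw [show 1 - (x - b ^ 5) = 1 - x + b ^ 5 by ring] at hleftgap
  rw [← hGdef, ← hPdef] at htaylor
  set T := kc * b ^ 4 / (2 * (1 - ξ)) * (1 + b ^ 5 / (1 - ξ)) ^ (kc * a) with hTdef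
  have hTeq : kc * a / (2 * (1 - ξ)) * (b ^ 5) ^ 2 * (1 + b ^ 5 / (1 - ξ)) ^ (kc * a) * P =
      b ^ 5 * T * P := by
    calc _ = (a * b) * (b ^ 5 * T * P) := by rw [hTdef]; ring
      _ = _ := by rw [hba, one_mul]
  rw [hTeq] at htaylor
  have hmain : b ^ 5 * -N ≤ d + b ^ 5 * P + b ^ 5 * T * P := by
    rw [hd]; linarith
  have hab5 : a ^ 5 * b ^ 5 = 1 := by rw [← mul_pow, hba, one_pow]
  have hfin : -N / P ≤ 1 + d / P * a ^ 5 + T := by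
    rw [div_le_iff₀ hP]
    have := mul_le_mul_of_nonneg_left hmain (pow_pos ha0 5).le
    calc -N = (a ^ 5 * b ^ 5) * -N := by rw [hab5, one_mul]
      _ ≤ a ^ 5 * (d + b ^ 5 * P + b ^ 5 * T * P) := by linarith
      _ = (a ^ 5 * b ^ 5) * (P + T * P) + d * a ^ 5 := by ring
      _ = _ := by rw [hab5]; field_simp; ring
  rw [div_neg, ← neg_div]
  have := mul_le_mul_of_nonneg_right hsqrt (pow_pos ha0 5).le
  linarith
end
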